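/- Let c₁, c₂ ∈ ℂ and let F(z) = (z² + c₁)² + c₂. If the forward orbit of 0 under F is unbounded and the forward orbit of every w ∈ ℂ with w² = −c₁ under F is unbounded, then the alternated Julia set, i.e. the topological frontier of the alternated filled Julia set K_{c₁c₂}, is a totally disconnected subset of ℂ. -/

import Mathlib

/-- The alternated orbit of `z₀` under the quadratic maps `z ↦ z² + c₁` (applied at even
indices) and `z ↦ z² + c₂` (applied at odd indices). -/
def altOrbit (c₁ c₂ z₀ : ℂ) : ℕ → ℂ
  | 0 => z₀
  | n + 1 => (altOrbit c₁ c₂ z₀ n) ^ 2 + (if Even n then c₁ else c₂)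

open Set Filter Topology Metric

theorem isPreconnected_setOf_lt_norm {R : ℝ} (hR : 0 < R) :
    IsPreconnected {z : ℂ | R < ‖z‖} := by
  have h : {z : ℂ | R < ‖z‖} = Complex.exp '' {z : ℂ | Real.log R < z.re} := by
    ext z
    simp only [mem_ofPred_eq, mem_image]
    constructor
    · intro hz
      refine ⟨Complex.log z, ?_, Complex.exp_log (norm_pos_iff.1 (hR.trans hz))⟩
      rw [Complex.log_re]
      exact Real.log_lt_log hR hz
    · rintro ⟨w, hw, rfl⟩
      rwa [Complex.norm_exp, ← Real.log_lt_iff_lt_exp hR]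
  rw [h]
  exact (convex_halfSpace_re_gt _).isPreconnected.image _ Complex.continuous_exp.continuousOn

theorem IsProperMap.exists_forall_lt_norm {f : ℂ → ℂ} (hf : IsProperMap f) (R : ℝ) :
    ∃ ρ : ℝ, 0 < ρ ∧ ∀ z, ρ < ‖z‖ → R < ‖f z‖ := by
  obtain ⟨ρ, hρ⟩ := (hf.isCompact_preimage (isCompact_closedBall
    (0 : ℂ) R)).isBounded.subset_closedBall 0
  refine ⟨max ρ 1, by positivity, fun z hz => ?_⟩
  by_contra! h
  have := hρ (show z ∈ f ⁻¹' closedBall 0 R by simpa using h)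
  rw [mem_closedBall_zero_iff] at this
  exact absurd ((le_max_left _ _).trans_lt hz) this.not_gt

/-- The preimage of a neighbourhood of infinity under a proper open self-map of the plane is
connected. -/
theorem IsProperMap.isPreconnected_setOf_lt_norm {f : ℂ → ℂ} (hf : IsProperMap f)
    (hfo : IsOpenMap f) {R : ℝ} (hR : 0 < R) : IsPreconnected {z : ℂ | R < ‖f z‖} := by
  set A : Set ℂ := {w : ℂ | R < ‖w‖} with hA
  have hAo : IsOpen A := isOpen_lt continuous_const continuous_norm
  have hAc : IsPreconnected A := _root_.isPreconnected_setOf_lt_norm hR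
  have hUo : IsOpen {z : ℂ | R < ‖f z‖} := hAo.preimage hf.continuous
  obtain ⟨ρ, hρ, hE⟩ := hf.exists_forall_lt_norm R
  have key : ∀ B₁ B₂ : Set ℂ, IsOpen B₁ → IsOpen B₂ → Disjoint B₁ B₂ →
      B₁ ∪ B₂ = {z : ℂ | R < ‖f z‖} → {z : ℂ | ρ < ‖z‖} ⊆ B₁ → ¬ B₂.Nonempty := by
    intro B₁ B₂ h₁ h₂ hd hu hEB ⟨b, hb⟩
    have hcl : Disjoint B₁ (closure B₂) := hd.closure_right h₁
    have hT : IsClosed (f '' closure B₂) := hf.isClosedMap _ isClosed_closure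
    obtain ⟨w, hwA, hw₂, hwT⟩ := hAc (f '' B₂) (f '' closure B₂)ᶜ (hfo _ h₂) hT.isOpen_compl
      (by
        intro w hw
        by_cases h : w ∈ f '' closure B₂
        · obtain ⟨z, hz, rfl⟩ := h
          have hz' : z ∈ B₁ ∪ B₂ := hu ▸ hw
          exact Or.inl ⟨z, hz'.resolve_left fun h => hcl.le_bot ⟨h, hz⟩, rfl⟩
        · exact Or.inr h)
      ⟨f b, (hu ▸ Or.inr hb : b ∈ {z : ℂ | R < ‖f z‖}), b, hb, rfl⟩
      (by
        obtain ⟨S, hS⟩ := ((isCompact_closedBall (0 : ℂ) ρ).image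
          hf.continuous).isBounded.subset_closedBall 0
        refine ⟨((max R S + 1 : ℝ) : ℂ), ?_, ?_⟩
        · simp only [hA, mem_ofPred_eq, Complex.norm_real, Real.norm_eq_abs]
          exact lt_of_lt_of_le (by linarith [le_max_left R S]) (le_abs_self _)
        · rintro ⟨z, hz, hzw⟩
          have hz₁ : ‖z‖ ≤ ρ := by
            by_contra! h
            exact hcl.le_bot ⟨hEB h, hz⟩
          have := hS ⟨z, mem_closedBall_zero_iff.2 hz₁, rfl⟩
          rw [hzw, mem_closedBall_zero_iff, Complex.norm_real, Real.norm_eq_abs] at this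
          linarith [le_abs_self (max R S + 1), le_max_right R S])
    exact hwT (image_mono subset_closure hw₂)
  rw [isPreconnected_iff_subset_of_disjoint]
  intro u v hu hv huv hd
  have hdisj : Disjoint ({z : ℂ | R < ‖f z‖} ∩ u) ({z : ℂ | R < ‖f z‖} ∩ v) := by
    rw [Set.disjoint_iff_inter_eq_empty, ← hd]
    ext; simp; tauto
  have hun : {z : ℂ | R < ‖f z‖} ∩ u ∪ {z : ℂ | R < ‖f z‖} ∩ v = {z : ℂ | R < ‖f z‖} := by
    rw [← inter_union_distrib_left, inter_eq_left.2 huv]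
  have hEU : {z : ℂ | ρ < ‖z‖} ⊆ {z : ℂ | R < ‖f z‖} := fun z hz => hE z hz
  rcases isPreconnected_iff_subset_of_disjoint.1 (_root_.isPreconnected_setOf_lt_norm hρ) u v hu hv
    (hEU.trans huv) (subset_eq_empty (inter_subset_inter_left _ hEU) hd) with h | h
  · left
    have := key _ _ (hUo.inter hu) (hUo.inter hv) hdisj hun (subset_inter hEU h)
    intro z hz
    exact (huv hz).resolve_right fun hzv => this ⟨z, hz, hzv⟩
  · right
    have := key _ _ (hUo.inter hv) (hUo.inter hu) hdisj.symm (by rw [union_comm, hun])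
      (subset_inter hEU h)
    intro z hz
    exact (huv hz).resolve_left fun hzv => this ⟨z, hz, hzv⟩

theorem Complex.exists_differentiableOn_sq_eq_sub_of_norm_lt {W : Set ℂ} {a b : ℂ}
    (h : ∀ w ∈ W, ‖a - b‖ < ‖w - b‖) :
    (∃ s : ℂ → ℂ, DifferentiableOn ℂ s W ∧ ∀ w ∈ W, s w ^ 2 = w - a) ↔
      ∃ s : ℂ → ℂ, DifferentiableOn ℂ s W ∧ ∀ w ∈ W, s w ^ 2 = w - b := by
  have hne : ∀ w ∈ W, w - b ≠ 0 := fun w hw =>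
    norm_pos_iff.1 ((norm_nonneg _).trans_lt (h w hw))
  have hsl : ∀ w ∈ W, (w - a) / (w - b) ∈ Complex.slitPlane := by
    intro w hw
    have : (w - a) / (w - b) = 1 + (-(a - b) / (w - b)) := by
      field_simp [hne w hw]; ring
    rw [this]
    apply Complex.mem_slitPlane_of_norm_lt_one
    rw [norm_div, norm_neg, div_lt_one (norm_pos_iff.2 (hne w hw))]
    exact h w hw
  set r : ℂ → ℂ := fun w => ((w - a) / (w - b)) ^ (1 / 2 : ℂ) with hr
  have hrd : DifferentiableOn ℂ r W := by
    apply DifferentiableOn.cpow_const _ hsl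
    exact (differentiableOn_id.sub_const _).div (differentiableOn_id.sub_const _) hne
  have hr2 : ∀ w, r w ^ 2 = (w - a) / (w - b) := fun w => by
    rw [hr, ← Complex.cpow_nat_mul]; simp
  have hr0 : ∀ w ∈ W, r w ≠ 0 := fun w hw h0 => by
    have := hr2 w
    rw [h0] at this
    exact Complex.slitPlane_ne_zero (hsl w hw) (by rw [← this]; simp)
  constructor
  · rintro ⟨s, hs, hs2⟩
    refine ⟨fun w => s w / r w, hs.div hrd hr0, fun w hw => ?_⟩
    have : w - a ≠ 0 := fun h0 => Complex.slitPlane_ne_zero (hsl w hw) (by simp [h0])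
    rw [div_pow, hr2, hs2 w hw]
    have := hne w hw
    field_simp
  · rintro ⟨s, hs, hs2⟩
    refine ⟨fun w => s w * r w, hs.mul hrd, fun w hw => ?_⟩
    rw [mul_pow, hr2, hs2 w hw, mul_div_cancel₀ _ (hne w hw)]

/-- If the bounded set `W` misses a connected neighbourhood `A` of infinity, then `w - a` has a
holomorphic square root on `W` for every `a ∈ A`. -/
theorem Complex.exists_differentiableOn_sq_eq_sub {W A : Set ℂ} (hA : IsOpen A)
    (hAc : IsPreconnected A) (hWA : Disjoint W A) {ρ : ℝ} (hρ : ∀ z : ℂ, ρ < ‖z‖ → z ∈ A)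
    {a : ℂ} (ha : a ∈ A) :
    ∃ s : ℂ → ℂ, DifferentiableOn ℂ s W ∧ ∀ w ∈ W, s w ^ 2 = w - a := by
  set Q : ℂ → Prop := fun a => ∃ s : ℂ → ℂ, DifferentiableOn ℂ s W ∧ ∀ w ∈ W, s w ^ 2 = w - a
  have hloc : ∀ x ∈ A, ∀ᶠ y in 𝓝 x, y ∈ A ∧ (Q y ↔ Q x) := by
    intro x hx
    obtain ⟨ε, hε, hb⟩ := Metric.isOpen_iff.1 hA x hx
    filter_upwards [ball_mem_nhds x hε] with y hy
    refine ⟨hb hy, Complex.exists_differentiableOn_sq_eq_sub_of_norm_lt fun w hw => ?_⟩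
    have h1 : ε ≤ ‖w - x‖ := by
      by_contra! h
      exact hWA.le_bot ⟨hw, hb (by simpa [dist_eq_norm] using h)⟩
    rw [mem_ball, dist_eq_norm] at hy
    exact hy.trans_le h1
  have hbase : ∃ b ∈ A, Q b := by
    set t : ℝ := max ρ 0 + 1
    have ht : 0 < t := by positivity
    have htρ : ρ < t := by linarith [le_max_left ρ 0]
    have hnt : ‖(t : ℂ)‖ = t := by rw [Complex.norm_real, Real.norm_eq_abs, abs_of_pos ht]
    refine ⟨(t : ℂ), hρ _ (by rwa [hnt]), fun w => (-t) ^ (1 / 2 : ℂ) * (1 + -w / t) ^ (1 / 2 : ℂ),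
      ?_, ?_⟩
    · refine DifferentiableOn.const_mul (DifferentiableOn.cpow_const ?_ fun w hw => ?_) _
      · fun_prop
      · apply Complex.mem_slitPlane_of_norm_lt_one
        rw [norm_div, norm_neg, hnt, div_lt_one ht]
        by_contra! h
        exact hWA.le_bot ⟨hw, hρ w (htρ.trans_le h)⟩
    · intro w _
      have ht' : (t : ℂ) ≠ 0 := by exact_mod_cast ht.ne'
      rw [mul_pow, ← Complex.cpow_nat_mul, ← Complex.cpow_nat_mul]
      norm_num
      field_simp
      ring
  by_contra hna
  obtain ⟨b, hb, hQb⟩ := hbase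
  obtain ⟨x, hx, ⟨-, h1⟩, -, h2⟩ := hAc {x | x ∈ A ∧ Q x} {x | x ∈ A ∧ ¬ Q x}
    (isOpen_iff_mem_nhds.2 fun x hx => (hloc x hx.1).mono fun y hy => ⟨hy.1, hy.2.2 hx.2⟩)
    (isOpen_iff_mem_nhds.2 fun x hx => (hloc x hx.1).mono fun y hy =>
      ⟨hy.1, fun h => hx.2 (hy.2.1 h)⟩)
    (fun x hx => by by_cases h : Q x; exacts [Or.inl ⟨hx, h⟩, Or.inr ⟨hx, h⟩])
    ⟨b, hb, hb, hQb⟩ ⟨a, ha, ha, hna⟩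
  exact h2 h1

theorem IsPreconnected.dist_le_of_subset_iUnion_closedBall {C : Set ℂ} (hC : IsPreconnected C)
    {ι : Type*} (t : Finset ι) (p : ι → ℂ) {ε : ℝ} (hε : 0 ≤ ε)
    (hsub : C ⊆ ⋃ i ∈ t, closedBall (p i) ε) {x y : ℂ} (hx : x ∈ C) (hy : y ∈ C) :
    dist y x ≤ t.card * (2 * ε) := by
  have hI : Icc 0 (dist y x) ⊆ ⋃ i ∈ t, closedBall (dist (p i) x) ε := by
    intro s hs
    have hs' : s ∈ Icc (dist x x) (dist y x) := by simpa using hs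
    obtain ⟨z, hz, rfl⟩ := hC.intermediate_value hx hy
      (f := fun z => dist z x) (by fun_prop) hs'
    obtain ⟨i, hi, hzi⟩ := mem_iUnion₂.1 (hsub hz)
    exact mem_iUnion₂.2 ⟨i, hi, (dist_dist_dist_le_left z (p i) x).trans hzi⟩
  have := (MeasureTheory.measure_mono (μ := MeasureTheory.volume) hI).trans
    (MeasureTheory.measure_biUnion_finset_le t _)
  simp only [Real.volume_Icc, Real.volume_closedBall, sub_zero, Finset.sum_const,
    nsmul_eq_mul] at this
  rw [← ENNReal.ofReal_natCast, ← ENNReal.ofReal_mul (by positivity),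
    ENNReal.ofReal_le_ofReal_iff (by positivity)] at this
  exact this

/-- Iterating branches that map `W` well inside itself contracts the infinitesimal Carathéodory
metric of `W` geometrically. -/
theorem exists_iterated_branch {W J : Set ℂ} {R δ : ℝ} (hW : IsOpen W) (hWR : W ⊆ ball 0 R)
    (hR : 0 < R) (hδ : 0 < δ)
    (hbr : ∀ C ⊆ J, IsPreconnected C → ∃ g : ℂ → ℂ, DifferentiableOn ℂ g W ∧
      (∀ w ∈ W, ball (g w) δ ⊆ W) ∧ ∃ C' ⊆ J, IsPreconnected C' ∧ C ⊆ g '' C')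
    (k : ℕ) : ∀ C ⊆ J, IsPreconnected C → ∃ G : ℂ → ℂ, DifferentiableOn ℂ G W ∧ MapsTo G W W ∧
      C ⊆ G '' J ∧ ∀ x r, 0 < r → ball x r ⊆ W → ∀ f : ℂ → ℂ, DifferentiableOn ℂ f W →
        MapsTo f W (ball 0 1) → (1 + δ / (2 * R)) ^ k * ‖deriv (f ∘ G) x‖ ≤ 2 / r := by
  induction k with
  | zero =>
    refine fun C hC _ => ⟨id, differentiableOn_id, mapsTo_id _, by simpa using hC, ?_⟩
    intro x r hr hxr f hf hfm
    rw [pow_zero, one_mul, Function.comp_id]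
    refine Complex.norm_deriv_le_div_of_mapsTo_ball (hf.mono hxr) (fun z hz => ?_) hr
    have h1 := mem_ball_zero_iff.1 (hfm (hxr hz))
    have h2 := mem_ball_zero_iff.1 (hfm (hxr (mem_ball_self hr)))
    rw [mem_closedBall, dist_eq_norm]
    linarith [norm_sub_le (f z) (f x)]
  | succ k ih =>
    intro C hC hCc
    obtain ⟨g, hg, hgW, C', hC', hCc', hsub⟩ := hbr C hC hCc
    obtain ⟨G, hG, hGW, hGC, hGd⟩ := ih C' hC' hCc'
    have hgm : MapsTo g W W := fun w hw => hgW w hw (mem_ball_self hδ)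
    refine ⟨g ∘ G, hg.comp hG hGW, hgm.comp hGW, ?_, ?_⟩
    · rw [image_comp]
      exact hsub.trans (image_mono hGC)
    intro x r hr hxr f hf hfm
    have hx : x ∈ W := hxr (mem_ball_self hr)
    set η : ℝ := δ / (2 * R) with hη
    have hη0 : 0 < η := by positivity
    set h : ℂ → ℂ := fun z => g z + η * (g z - g (G x)) with hh
    have hhW : MapsTo h W W := by
      intro z hz
      apply hgW z hz
      have h1 := mem_ball_zero_iff.1 (hWR (hgm hz))
      have h2 := mem_ball_zero_iff.1 (hWR (hgm (hGW hx)))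
      have h3 : ‖g z - g (G x)‖ < 2 * R := by linarith [norm_sub_le (g z) (g (G x))]
      rw [mem_ball, dist_eq_norm, hh, add_sub_cancel_left, norm_mul, Complex.norm_real,
        Real.norm_eq_abs, abs_of_pos hη0]
      calc η * ‖g z - g (G x)‖ < η * (2 * R) := by gcongr
        _ = δ := by rw [hη]; field_simp
    have hhd : DifferentiableOn ℂ h W := by
      exact hg.add ((hg.sub_const _).const_mul _)
    have key := hGd x r hr hxr (f ∘ h) (hf.comp hhd hhW) (hfm.comp hhW)
    have dG := (hG.differentiableAt (hW.mem_nhds hx)).hasDerivAt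
    have dg := (hg.differentiableAt (hW.mem_nhds (hGW hx))).hasDerivAt
    have df := (hf.differentiableAt (hW.mem_nhds (hgm (hGW hx)))).hasDerivAt
    have dh : HasDerivAt h ((1 + η) * deriv g (G x)) (G x) := by
      have := dg.add ((dg.sub_const (g (G x))).const_mul (η : ℂ))
      convert! this using 1
      ring
    have hhx : h (G x) = g (G x) := by simp [hh]
    have e1 := (HasDerivAt.comp x (HasDerivAt.comp (G x) (hhx.symm ▸ df) dh) dG).deriv
    have e2 := (HasDerivAt.comp x df (HasDerivAt.comp x dg dG)).deriv
    rw [e1, hhx] at key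
    rw [e2]
    have hn : ‖(1 + η : ℂ)‖ = 1 + η := by
      rw [← Complex.ofReal_one, ← Complex.ofReal_add, Complex.norm_real, Real.norm_eq_abs,
        abs_of_pos (by positivity)]
    simp only [norm_mul, hn] at key ⊢
    calc _ = _ := by ring
      _ ≤ _ := key

theorem isTotallyDisconnected_of_branches {W J : Set ℂ} {R δ : ℝ} (hW : IsOpen W)
    (hWR : W ⊆ ball 0 R) (hδ : 0 < δ) (hJ : IsCompact J) (hJW : J ⊆ W)
    (hbr : ∀ C ⊆ J, IsPreconnected C → ∃ g : ℂ → ℂ, DifferentiableOn ℂ g W ∧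
      (∀ w ∈ W, ball (g w) δ ⊆ W) ∧ ∃ C' ⊆ J, IsPreconnected C' ∧ C ⊆ g '' C') :
    IsTotallyDisconnected J := by
  intro C hCJ hC x hx y hy
  have hR : 0 < R := pos_of_mem_ball (hWR (hJW (hCJ hx)))
  obtain ⟨r₀, hr₀, hthick⟩ := hJ.exists_thickening_subset_open hW hJW
  set r := r₀ / 2 with hr
  have hr0 : 0 < r := by positivity
  obtain ⟨t, htJ, htf, ht⟩ := hJ.finite_cover_balls hr0
  lift t to Finset ℂ using htf
  set η : ℝ := δ / (2 * R) with hη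
  have hη0 : 0 < η := by positivity
  have hbound : ∀ k : ℕ, dist y x ≤ t.card * (2 * (2 * R / (1 + η) ^ k)) := by
    intro k
    obtain ⟨G, hG, hGW, hGC, hGd⟩ := exists_iterated_branch hW hWR hR hδ hbr k C hCJ hC
    refine hC.dist_le_of_subset_iUnion_closedBall t G (by positivity) ?_ hx hy
    intro c hc
    obtain ⟨z, hz, rfl⟩ := hGC hc
    obtain ⟨p, hp, hzp⟩ := mem_iUnion₂.1 (ht hz)
    refine mem_iUnion₂.2 ⟨p, hp, ?_⟩
    have hballs : ∀ u ∈ ball p r, ball u r ⊆ W := by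
      intro u hu v hv
      apply hthick
      rw [mem_thickening_iff]
      refine ⟨p, htJ hp, ?_⟩
      rw [mem_ball] at hu hv
      linarith [dist_triangle v u p]
    have hdG : ∀ u ∈ ball p r, DifferentiableAt ℂ G u := fun u hu =>
      hG.differentiableAt (hW.mem_nhds (hballs u hu (mem_ball_self hr0)))
    have hder : ∀ u ∈ ball p r, ‖deriv G u‖ ≤ 2 * R / (r * (1 + η) ^ k) := by
      intro u hu
      have := hGd u r hr0 (hballs u hu) (fun z => (R : ℂ)⁻¹ * z) (by fun_prop) (fun w hw => by
        have := mem_ball_zero_iff.1 (hWR hw)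
        rw [mem_ball_zero_iff, norm_mul, norm_inv, Complex.norm_real, Real.norm_eq_abs,
          abs_of_pos hR, inv_mul_lt_iff₀ hR]
        simpa using this)
      have e : deriv ((fun z => (R : ℂ)⁻¹ * z) ∘ G) u = (R : ℂ)⁻¹ * deriv G u :=
        ((hdG u hu).hasDerivAt.const_mul _).deriv
      rw [e, norm_mul, norm_inv, Complex.norm_real, Real.norm_eq_abs, abs_of_pos hR] at this
      rw [le_div_iff₀ (by positivity)]
      rw [le_div_iff₀ hr0] at this
      calc _ = R * ((1 + η) ^ k * (R⁻¹ * ‖deriv G u‖) * r) := by field_simp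
        _ ≤ R * 2 := by gcongr
        _ = _ := by ring
    have := (convex_ball p r).norm_image_sub_le_of_norm_deriv_le hdG hder (mem_ball_self hr0) hzp
    rw [mem_closedBall, dist_eq_norm]
    refine this.trans ?_
    rw [mem_ball, dist_eq_norm] at hzp
    calc _ ≤ 2 * R / (r * (1 + η) ^ k) * r := by gcongr
      _ = _ := by field_simp
  have hlim : Tendsto (fun k : ℕ => (t.card : ℝ) * (2 * (2 * R / (1 + η) ^ k))) atTop (𝓝 0) := by
    have : Tendsto (fun k : ℕ => 2 * R / (1 + η) ^ k) atTop (𝓝 0) :=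
      tendsto_const_nhds.div_atTop (tendsto_pow_atTop_atTop_of_one_lt (by linarith))
    simpa using (this.const_mul 2).const_mul (t.card : ℝ)
  exact (dist_le_zero.1 (ge_of_tendsto' hlim hbound)).symm

theorem IsProperMap.iterate {X : Type*} [TopologicalSpace X] {f : X → X} (hf : IsProperMap f)
    (n : ℕ) : IsProperMap f^[n] := by
  induction n with
  | zero => exact isProperMap_id
  | succ n ih => exact ih.comp hf

theorem IsOpenMap.iterate {X : Type*} [TopologicalSpace X] {f : X → X} (hf : IsOpenMap f)
    (n : ℕ) : IsOpenMap f^[n] := by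
  induction n with
  | zero => exact IsOpenMap.id
  | succ n ih => exact ih.comp hf

theorem isProperMap_sq_add (c : ℂ) : IsProperMap fun z : ℂ => z ^ 2 + c := by
  have := Polynomial.isProperMap_eval (R := ℂ) (Polynomial.X ^ 2 + Polynomial.C c)
    (by rw [Polynomial.degree_X_pow_add_C (by norm_num)]; norm_num)
  simpa using this

theorem isOpenMap_sq_add (c : ℂ) : IsOpenMap fun z : ℂ => z ^ 2 + c := by
  have h : Differentiable ℂ fun z : ℂ => z ^ 2 + c := by fun_prop
  refine (AnalyticOnNhd.is_constant_or_isOpenMap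
    (h.differentiableOn.analyticOnNhd isOpen_univ)).resolve_left ?_
  rintro ⟨w, hw⟩
  have := (hw 0).trans (hw 1).symm
  simp at this

theorem two_mul_norm_le_norm_sq_add {c z : ℂ} {R : ℝ} (hR : 3 + ‖c‖ ≤ R) (hz : R ≤ ‖z‖) :
    2 * ‖z‖ ≤ ‖z ^ 2 + c‖ := by
  have h1 : ‖z‖ ^ 2 ≤ ‖z ^ 2 + c‖ + ‖c‖ := by
    calc ‖z‖ ^ 2 = ‖z ^ 2 + c - c‖ := by rw [add_sub_cancel_right, norm_pow]
      _ ≤ _ := norm_sub_le _ _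
  nlinarith [norm_nonneg c]

theorem pow_mul_norm_le_norm_iterate {F : ℂ → ℂ} {R : ℝ}
    (hF : ∀ z, R ≤ ‖z‖ → 2 * ‖z‖ ≤ ‖F z‖) {z : ℂ} (hz : R ≤ ‖z‖) (n : ℕ) :
    2 ^ n * ‖z‖ ≤ ‖F^[n] z‖ := by
  induction n with
  | zero => simp
  | succ n ih =>
    rw [Function.iterate_succ_apply']
    have h1 : ‖z‖ ≤ 2 ^ n * ‖z‖ :=
      le_mul_of_one_le_left (norm_nonneg _) (one_le_pow₀ (by norm_num))
    calc _ = 2 * (2 ^ n * ‖z‖) := by ring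
      _ ≤ 2 * ‖F^[n] z‖ := by gcongr
      _ ≤ _ := hF _ (hz.trans (h1.trans ih))

theorem norm_le_norm_iterate {F : ℂ → ℂ} {R : ℝ}
    (hF : ∀ z, R ≤ ‖z‖ → 2 * ‖z‖ ≤ ‖F z‖) {z : ℂ} (hz : R ≤ ‖z‖) (n : ℕ) :
    ‖z‖ ≤ ‖F^[n] z‖ :=
  (le_mul_of_one_le_left (norm_nonneg _) (one_le_pow₀ (by norm_num))).trans
    (pow_mul_norm_le_norm_iterate hF hz n)

theorem altOrbit_two_mul (c₁ c₂ z : ℂ) (k : ℕ) :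
    altOrbit c₁ c₂ z (2 * k) = (fun z : ℂ => (z ^ 2 + c₁) ^ 2 + c₂)^[k] z := by
  induction k with
  | zero => rfl
  | succ k ih =>
    rw [Function.iterate_succ_apply', ← ih, Nat.mul_succ]
    simp [altOrbit]

/-- If the critical values of `z ↦ (z² + c₁)² + c₂` lie outside `W`, where `W` is the preimage of
a disc under a proper open map, then on connected sets mapped into `W` this quartic is inverted by
holomorphic maps defined on all of `W`. -/
theorem exists_branch {f : ℂ → ℂ} (hf : IsProperMap f) (hfo : IsOpenMap f) {c₁ c₂ : ℂ} {R : ℝ}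
    (hR : 0 < R) (h₂ : R < ‖f c₂‖) (h₁ : R < ‖f (c₁ ^ 2 + c₂)‖) {C : Set ℂ}
    (hC : IsPreconnected C) (hCW : ∀ z ∈ C, ‖f ((z ^ 2 + c₁) ^ 2 + c₂)‖ < R) :
    ∃ g : ℂ → ℂ, DifferentiableOn ℂ g {w | ‖f w‖ < R} ∧
      (∀ w, ‖f w‖ < R → (g w ^ 2 + c₁) ^ 2 + c₂ = w) ∧
      ∀ z ∈ C, g ((z ^ 2 + c₁) ^ 2 + c₂) = z := by
  have sqrt : ∀ {h : ℂ → ℂ}, IsProperMap h → IsOpenMap h → ∀ {a : ℂ}, R < ‖h a‖ →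
      ∃ s : ℂ → ℂ, DifferentiableOn ℂ s {w | ‖h w‖ < R} ∧
        ∀ w ∈ {w | ‖h w‖ < R}, s w ^ 2 = w - a := by
    intro h hh hho a ha
    obtain ⟨ρ, -, hρ⟩ := hh.exists_forall_lt_norm R
    refine Complex.exists_differentiableOn_sq_eq_sub (A := {z | R < ‖h z‖})
      (isOpen_lt continuous_const hh.continuous.norm) (hh.isPreconnected_setOf_lt_norm hho hR)
      ?_ hρ ha
    rw [Set.disjoint_left]
    exact fun w hw hw' => lt_asymm (a := ‖h w‖) hw hw'
  obtain ⟨S, hSd, hS⟩ := sqrt hf hfo h₂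
  obtain ⟨T, hTd, hT⟩ := sqrt (hf.comp (isProperMap_sq_add c₂)) (hfo.comp (isOpenMap_sq_add c₂))
    (a := c₁) h₁
  have hS0 : ∀ w, ‖f w‖ < R → S w ≠ 0 := by
    intro w hw h0
    have := hS w hw
    rw [h0, zero_pow two_ne_zero] at this
    rw [← sub_eq_zero.1 this.symm] at h₂
    exact lt_asymm h₂ hw
  have hT0 : ∀ u : ℂ, ‖f (u ^ 2 + c₂)‖ < R → T u ≠ 0 := by
    intro u hu h0
    have := hT u hu
    rw [h0, zero_pow two_ne_zero] at this
    rw [← sub_eq_zero.1 this.symm] at h₁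
    exact lt_asymm h₁ hu
  obtain ⟨ε, hε, hεC⟩ : ∃ ε : ℂ, ε ^ 2 = 1 ∧
      ∀ z ∈ C, z ^ 2 + c₁ = ε * S ((z ^ 2 + c₁) ^ 2 + c₂) := by
    rcases hC.eq_or_eq_neg_of_sq_eq (f := fun z => z ^ 2 + c₁)
      (g := fun z => S ((z ^ 2 + c₁) ^ 2 + c₂)) (by fun_prop)
      (hSd.continuousOn.comp (by fun_prop) hCW)
      (fun z hz => by simp [hS _ (hCW z hz)])
      (fun {z} hz => hS0 _ (hCW z hz)) with h | h
    · exact ⟨1, by simp, fun z hz => by simpa using h hz⟩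
    · exact ⟨-1, by simp, fun z hz => by simpa using h hz⟩
  have hεS : ∀ w, ‖f w‖ < R → (ε * S w) ^ 2 + c₂ = w := fun w hw => by
    rw [mul_pow, hε, hS w hw]; ring
  have hm : MapsTo (fun w => ε * S w) {w | ‖f w‖ < R} {u | ‖f (u ^ 2 + c₂)‖ < R} := by
    intro w hw
    rw [mem_ofPred_eq] at hw ⊢
    rwa [hεS w hw]
  have hTS : DifferentiableOn ℂ (fun w => T (ε * S w)) {w | ‖f w‖ < R} :=
    hTd.comp (hSd.const_mul ε) hm
  obtain ⟨η, hη, hηC⟩ : ∃ η : ℂ, η ^ 2 = 1 ∧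
      ∀ z ∈ C, z = η * T (ε * S ((z ^ 2 + c₁) ^ 2 + c₂)) := by
    rcases hC.eq_or_eq_neg_of_sq_eq (f := fun z => z)
      (g := fun z => T (ε * S ((z ^ 2 + c₁) ^ 2 + c₂))) (by fun_prop)
      (hTS.continuousOn.comp (f := fun z => (z ^ 2 + c₁) ^ 2 + c₂) (by fun_prop) hCW)
      (fun z hz => by
        simp only [Pi.pow_apply]
        refine (eq_sub_of_add_eq (hεC z hz)).trans (hT _ (hm (hCW z hz))).symm)
      (fun {z} hz => hT0 _ (hm (hCW z hz))) with h | h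
    · exact ⟨1, by simp, fun z hz => by simpa using h hz⟩
    · exact ⟨-1, by simp, fun z hz => by simpa using h hz⟩
  refine ⟨fun w => η * T (ε * S w), hTS.const_mul η, fun w hw => ?_, fun z hz => (hηC z hz).symm⟩
  rw [mul_pow, hη, hT _ (hm hw), one_mul, sub_add_cancel, hεS w hw]

/-- Let `F(z) = (z² + c₁)² + c₂`. If the forward orbit of `0` under `F`
is unbounded and the forward orbit of every square root of `-c₁` under `F` is
unbounded, then the alternated Julia set (the frontier of the alternated filled Julia
set `K_{c₁c₂}`) is totally disconnected. -/
theorem alternated_julia_totallyDisconnected_of_critical_orbits_unbounded (c₁ c₂ : ℂ)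
    (h0 : ¬ ∃ M : ℝ, 0 ≤ M ∧
      ∀ n : ℕ, ‖(fun z : ℂ => (z ^ 2 + c₁) ^ 2 + c₂)^[n] 0‖ ≤ M)
    (hw : ∀ w : ℂ, w ^ 2 = -c₁ →
      ¬ ∃ M : ℝ, 0 ≤ M ∧ ∀ n : ℕ, ‖(fun z : ℂ => (z ^ 2 + c₁) ^ 2 + c₂)^[n] w‖ ≤ M) :
    IsTotallyDisconnected (frontier {z₀ : ℂ |
      ∃ M : ℝ, 0 ≤ M ∧ ∀ n : ℕ, ‖altOrbit c₁ c₂ z₀ n‖ ≤ M}) := by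
  set F : ℂ → ℂ := fun z => (z ^ 2 + c₁) ^ 2 + c₂ with hFdef
  set R : ℝ := 3 + ‖c₁‖ + ‖c₂‖ with hRdef
  have hR : 0 < R := by positivity
  have hF : ∀ z, R ≤ ‖z‖ → 2 * ‖z‖ ≤ ‖F z‖ := by
    intro z hz
    have h1 := two_mul_norm_le_norm_sq_add (c := c₁) (by linarith [norm_nonneg c₂]) hz
    have h2 := two_mul_norm_le_norm_sq_add (c := c₂) (R := R) (z := z ^ 2 + c₁)
      (by linarith [norm_nonneg c₁]) (by linarith)
    exact (by linarith : 2 * ‖z‖ ≤ _).trans h2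
  have hFp : IsProperMap F := (isProperMap_sq_add c₂).comp (isProperMap_sq_add c₁)
  have hFo : IsOpenMap F := (isOpenMap_sq_add c₂).comp (isOpenMap_sq_add c₁)
  have escape : ∀ z : ℂ, (¬ ∃ M : ℝ, 0 ≤ M ∧ ∀ n : ℕ, ‖F^[n] z‖ ≤ M) →
      ∃ m, ∀ n, m ≤ n → R < ‖F^[n] z‖ := by
    intro z hz
    push Not at hz
    obtain ⟨m, hm⟩ := hz R hR.le
    refine ⟨m, fun n hn => ?_⟩
    obtain ⟨k, rfl⟩ := Nat.exists_eq_add_of_le' hn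
    rw [Function.iterate_add_apply]
    exact hm.trans_le (norm_le_norm_iterate hF hm.le k)
  obtain ⟨w, hwc⟩ := IsAlgClosed.exists_pow_nat_eq (-c₁) two_pos
  obtain ⟨m₁, hm₁⟩ := escape 0 h0
  obtain ⟨m₂, hm₂⟩ := escape w (hw w hwc)
  set n := max m₁ m₂
  have hcrit₁ : R < ‖F^[n] (c₁ ^ 2 + c₂)‖ := by
    have := hm₁ (n + 1) (by omega)
    rw [Function.iterate_succ_apply] at this
    simpa [hFdef] using this
  have hcrit₂ : R < ‖F^[n] c₂‖ := by
    have := hm₂ (n + 1) (by omega)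
    rw [Function.iterate_succ_apply] at this
    simpa [hFdef, hwc] using this
  have hlt : ∀ z, ‖F z‖ ≤ R → ‖z‖ < R := by
    intro z hz
    by_contra! h
    linarith [hF z h]
  set J : Set ℂ := {z | ∀ k, ‖F^[k] z‖ ≤ R} with hJdef
  have hJcl : IsClosed J := by
    rw [hJdef, ofPred_forall]
    exact isClosed_iInter fun k => isClosed_le (hFp.iterate k).continuous.norm continuous_const
  have hJ : IsCompact J := (isCompact_closedBall (0 : ℂ) R).of_isClosed_subset hJcl
    fun z hz => mem_closedBall_zero_iff.2 (hz 0)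
  have hFJ : MapsTo F J J := fun z hz k => hz (k + 1)
  have hJlt : ∀ z ∈ J, ∀ k, ‖F^[k] z‖ < R := fun z hz k =>
    hlt _ (Function.iterate_succ_apply' F k z ▸ hz (k + 1))
  have hKJ : {z₀ : ℂ | ∃ M : ℝ, 0 ≤ M ∧ ∀ n : ℕ, ‖altOrbit c₁ c₂ z₀ n‖ ≤ M} ⊆ J := by
    rintro z ⟨M, -, hM⟩ m
    by_contra! h
    obtain ⟨k, hk⟩ := pow_unbounded_of_one_lt (M / R) (one_lt_two (α := ℝ))
    have h1 := hM (2 * (k + m))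
    rw [altOrbit_two_mul, Function.iterate_add_apply] at h1
    have h2 := pow_mul_norm_le_norm_iterate hF h.le k
    rw [div_lt_iff₀ hR] at hk
    have h3 : (2 : ℝ) ^ k * R ≤ 2 ^ k * ‖F^[m] z‖ := by gcongr
    exact absurd (h3.trans (h2.trans h1)) hk.not_ge
  suffices IsTotallyDisconnected J from
    fun t ht => this t (ht.trans (frontier_subset_closure.trans (closure_minimal hKJ hJcl)))
  set W : Set ℂ := {z | ‖F^[n] z‖ < R}
  have hW : IsOpen W := isOpen_lt (hFp.iterate n).continuous.norm continuous_const
  have hWR : W ⊆ ball 0 R := by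
    intro z hz
    rw [mem_ball_zero_iff]
    by_contra! h
    exact absurd (h.trans (norm_le_norm_iterate hF h n)) (not_le_of_gt hz)
  have hL : IsCompact (F^[n + 1] ⁻¹' closedBall 0 R) :=
    (hFp.iterate (n + 1)).isCompact_preimage (isCompact_closedBall _ _)
  obtain ⟨δ, hδ, hthick⟩ := hL.exists_thickening_subset_open hW fun z hz => hlt _
    (Function.iterate_succ_apply' F n z ▸ mem_closedBall_zero_iff.1 hz)
  refine isTotallyDisconnected_of_branches hW hWR hδ hJ (fun z hz => hJlt z hz n) ?_
  intro C hC hCc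
  obtain ⟨g, hg, hFg, hgF⟩ := exists_branch (hFp.iterate n) (IsOpenMap.iterate hFo n) hR hcrit₂ hcrit₁ hCc
    fun z hz => hJlt _ (hFJ (hC hz)) n
  refine ⟨g, hg, fun w hw => ?_, F '' C, (hFJ.mono_left hC).image_subset,
    hCc.image _ hFp.continuous.continuousOn, fun z hz => ⟨F z, ⟨z, hz, rfl⟩, hgF z hz⟩⟩
  refine (ball_subset_thickening ?_ δ).trans hthick
  rw [mem_preimage, Function.iterate_succ_apply, mem_closedBall_zero_iff]
  have : F (g w) = w := hFg w hw
  rw [this]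
  exact le_of_lt hw
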